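/- Let p ≥ 1, let A be a p×p complex positive definite (self-adjoint) matrix, and let α be a complex number with Re(α) > p-1. Then ∫_{X > 0} det(X)^{α-p} e^{-tr(AX)} dμ_p(X) = Γ̃_p(α) · det(A)^{-α}, where the integral is over the cone of positive definite matrices in Herm(p); here tr(AX) is a positive real number for X > 0, det(A) is a positive real number, and the complex powers det(X)^{α-p} and det(A)^{-α} are powers of positive real numbers. -/

import Mathlib

open MeasureTheory Matrix
open scoped ComplexOrder

noncomputable section

/-- Parameter space `ℝ^p × ℂ^{p(p-1)/2}` for `p × p` Hermitian matrices:
the real diagonal entries together with the strictly upper-triangular complex entries. -/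
abbrev HermParam (p : ℕ) : Type :=
  (Fin p → ℝ) × ({ q : Fin p × Fin p // q.1 < q.2 } → ℂ)

/-- The linear isomorphism sending the parameters to the corresponding self-adjoint matrix. -/
def toHermMatrix (p : ℕ) (T : HermParam p) : Matrix (Fin p) (Fin p) ℂ :=
  Matrix.of fun i j =>
    if h : i < j then T.2 ⟨(i, j), h⟩
    else if h' : j < i then (starRingEnd ℂ) (T.2 ⟨(j, i), h'⟩)
    else (T.1 i : ℂ)

noncomputable instance matrixComplexMeasureSpace (m n : ℕ) :
    MeasureSpace (Matrix (Fin m) (Fin n) ℂ) :=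
  inferInstanceAs (MeasureSpace (Fin m → Fin n → ℂ))

/-- The Lebesgue measure `μ_p` on Herm(p), realized as a measure on the space of
`p × p` complex matrices: the pushforward of Lebesgue measure on the parameter space
under the linear isomorphism `toHermMatrix p`. -/
def hermLebesgue (p : ℕ) : Measure (Matrix (Fin p) (Fin p) ℂ) :=
  Measure.map (toHermMatrix p) volume

/-- The complex matrix-variate gamma function
`Γ̃_p(α) = π^{p(p-1)/2} ∏_{j=1}^p Γ(α - j + 1) = π^{p(p-1)/2} ∏_{j=0}^{p-1} Γ(α - j)`. -/
def cGammaP (p : ℕ) (α : ℂ) : ℂ :=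
  (Real.pi : ℂ) ^ (p * (p - 1) / 2) * ∏ j : Fin p, Complex.Gamma (α - j)

end

section Gaussian

variable {p : ℕ}

lemma integrable_exp_neg_sum_normSq (p : ℕ) :
    Integrable (fun y : Fin p → ℂ => Real.exp (-∑ i, ‖y i‖ ^ 2)) := by
  simp_rw [← Finset.sum_neg_distrib, Real.exp_sum]
  refine Integrable.fintype_prod (f := fun _ (z : ℂ) => Real.exp (-‖z‖ ^ 2)) fun _ => ?_
  have h := (GaussianFourier.integrable_cexp_neg_mul_sq_norm_add (V := ℂ) (b := 1) (by simp) 0 0).re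
  refine h.congr (ae_of_all _ fun z => ?_)
  simp only [RCLike.re_to_complex, zero_mul, add_zero]
  rw [show (-1 * (‖z‖ : ℂ) ^ 2) = ((-‖z‖ ^ 2 : ℝ) : ℂ) by push_cast; ring, Complex.exp_ofReal_re]

lemma integral_exp_neg_sum_normSq (p : ℕ) :
    ∫ y : Fin p → ℂ, Real.exp (-∑ i, ‖y i‖ ^ 2) = Real.pi ^ p := by
  simp_rw [← Finset.sum_neg_distrib, Real.exp_sum]
  rw [integral_fintype_prod_volume_eq_pow (fun z : ℂ => Real.exp (-‖z‖ ^ 2))]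
  have h := GaussianFourier.integral_rexp_neg_mul_sq_norm (V := ℂ) one_pos
  simp only [neg_mul, one_mul, div_one, Complex.finrank_real_complex] at h
  rw [h]
  simp

lemma map_mulVec_volume (B : Matrix (Fin p) (Fin p) ℂ) (hB : B.det ≠ 0) :
    Measure.map (fun y => B *ᵥ y) (volume : Measure (Fin p → ℂ)) =
      ENNReal.ofReal (Complex.normSq B.det)⁻¹ • volume := by
  have hdet : LinearMap.det ((Matrix.toLin' B).restrictScalars ℝ) = Complex.normSq B.det := by
    rw [LinearMap.det_restrictScalars, LinearMap.det_toLin', Algebra.norm_complex_apply]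
  have h := Measure.map_linearMap_addHaar_eq_smul_addHaar
    (f := (Matrix.toLin' B).restrictScalars ℝ) volume (by simpa [hdet] using hB)
  rw [hdet, abs_of_nonneg (inv_nonneg.2 (Complex.normSq_nonneg _))] at h
  exact h

lemma star_dotProduct_conjTranspose_mul_self_mulVec (B : Matrix (Fin p) (Fin p) ℂ)
    (y : Fin p → ℂ) :
    (star y ⬝ᵥ (Bᴴ * B) *ᵥ y).re = ∑ i, ‖(B *ᵥ y) i‖ ^ 2 := by
  rw [← mulVec_mulVec, dotProduct_mulVec, vecMul_conjTranspose, star_star]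
  simp only [dotProduct, Pi.star_apply, Complex.re_sum]
  refine Finset.sum_congr rfl fun i _ => ?_
  rw [← Complex.normSq_eq_norm_sq, Complex.star_def, ← Complex.normSq_eq_conj_mul_self,
    Complex.ofReal_re]

lemma integral_exp_neg_star_dotProduct_mulVec {G : Matrix (Fin p) (Fin p) ℂ} (hG : G.PosDef) :
    Integrable (fun y : Fin p → ℂ => Real.exp (-(star y ⬝ᵥ G *ᵥ y).re)) ∧
    ∫ y : Fin p → ℂ, Real.exp (-(star y ⬝ᵥ G *ᵥ y).re) = Real.pi ^ p / G.det.re := by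
  obtain ⟨B, rfl⟩ : ∃ B : Matrix (Fin p) (Fin p) ℂ, G = Bᴴ * B := by
    open scoped MatrixOrder in
    exact CStarAlgebra.nonneg_iff_eq_star_mul_self.mp hG.posSemidef.nonneg
  have hdet : (Bᴴ * B).det = (Complex.normSq B.det : ℝ) := by
    rw [det_mul, det_conjTranspose, Complex.star_def, Complex.normSq_eq_conj_mul_self]
  have hB : B.det ≠ 0 := by
    have := hG.det_pos.ne'
    rw [hdet] at this
    simpa using this
  simp_rw [star_dotProduct_conjTranspose_mul_self_mulVec]
  have hm : Measurable fun y : Fin p → ℂ => B *ᵥ y :=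
    (Continuous.matrix_mulVec continuous_const continuous_id).measurable
  have hi : Integrable (fun y : Fin p → ℂ => Real.exp (-∑ i, ‖y i‖ ^ 2))
      (Measure.map (fun y => B *ᵥ y) volume) := by
    rw [map_mulVec_volume B hB]
    exact (integrable_exp_neg_sum_normSq p).smul_measure ENNReal.ofReal_ne_top
  refine ⟨hi.comp_measurable hm, ?_⟩
  rw [← integral_map (f := fun y : Fin p → ℂ => Real.exp (-∑ i, ‖y i‖ ^ 2)) hm.aemeasurable hi.1,
    map_mulVec_volume B hB, integral_smul_measure, integral_exp_neg_sum_normSq,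
    ENNReal.toReal_ofReal (inv_nonneg.2 (Complex.normSq_nonneg _)), hdet, Complex.ofReal_re,
    smul_eq_mul, div_eq_inv_mul]

lemma complete_square {G : Matrix (Fin p) (Fin p) ℂ} (hG : G.PosDef) (b y : Fin p → ℂ) :
    (star (y + G⁻¹ *ᵥ b) ⬝ᵥ G *ᵥ (y + G⁻¹ *ᵥ b)).re =
      (star y ⬝ᵥ G *ᵥ y).re + 2 * (star b ⬝ᵥ y).re + (star b ⬝ᵥ G⁻¹ *ᵥ b).re := by
  have hu : IsUnit G.det := (isUnit_iff_isUnit_det G).1 hG.isUnit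
  have h1 : star (G⁻¹ *ᵥ b) = star b ᵥ* G⁻¹ := by
    rw [star_mulVec, hG.isHermitian.inv.eq]
  have h2 : (star y ⬝ᵥ b).re = (star b ⬝ᵥ y).re := by
    rw [star_dotProduct, ← Complex.conj_re, ← Complex.star_def, star_star]
  rw [star_add, mulVec_add, mulVec_mulVec, mul_nonsing_inv _ hu, one_mulVec, add_dotProduct,
    dotProduct_add, dotProduct_add, h1, ← dotProduct_mulVec, ← dotProduct_mulVec, mulVec_mulVec,
    nonsing_inv_mul _ hu, one_mulVec]
  simp only [Complex.add_re, h2]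
  ring

lemma integral_exp_neg_star_dotProduct_mulVec_sub {G : Matrix (Fin p) (Fin p) ℂ} (hG : G.PosDef)
    (b : Fin p → ℂ) :
    Integrable (fun y : Fin p → ℂ =>
      Real.exp (-(star y ⬝ᵥ G *ᵥ y).re - 2 * (star b ⬝ᵥ y).re)) ∧
    ∫ y : Fin p → ℂ, Real.exp (-(star y ⬝ᵥ G *ᵥ y).re - 2 * (star b ⬝ᵥ y).re) =
      Real.pi ^ p / G.det.re * Real.exp (star b ⬝ᵥ G⁻¹ *ᵥ b).re := by
  obtain ⟨hi, hv⟩ := integral_exp_neg_star_dotProduct_mulVec hG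
  have heq : (fun y : Fin p → ℂ =>
      Real.exp (-(star y ⬝ᵥ G *ᵥ y).re - 2 * (star b ⬝ᵥ y).re)) = fun y =>
      Real.exp (-(star (y + G⁻¹ *ᵥ b) ⬝ᵥ G *ᵥ (y + G⁻¹ *ᵥ b)).re) *
        Real.exp (star b ⬝ᵥ G⁻¹ *ᵥ b).re := by
    ext y
    rw [← Real.exp_add, complete_square hG]
    congr 1
    ring
  rw [heq]
  refine ⟨(hi.comp_add_right _).mul_const _, ?_⟩
  rw [integral_mul_const, integral_add_right_eq_self
    (fun y : Fin p → ℂ => Real.exp (-(star y ⬝ᵥ G *ᵥ y).re)), hv]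

lemma integral_exp_neg_star_dotProduct_mulVec_div_sub {G : Matrix (Fin p) (Fin p) ℂ}
    (hG : G.PosDef) (b : Fin p → ℂ) {x : ℝ} (hx : 0 < x) :
    Integrable (fun y : Fin p → ℂ =>
      Real.exp (-(star y ⬝ᵥ G *ᵥ y).re / x - 2 * (star b ⬝ᵥ y).re)) ∧
    ∫ y : Fin p → ℂ, Real.exp (-(star y ⬝ᵥ G *ᵥ y).re / x - 2 * (star b ⬝ᵥ y).re) =
      Real.pi ^ p * x ^ p / G.det.re * Real.exp (x * (star b ⬝ᵥ G⁻¹ *ᵥ b).re) := by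
  have hG' : (((x⁻¹ : ℝ) : ℂ) • G).PosDef := hG.smul (by
    rw [Complex.zero_lt_real]; exact inv_pos.2 hx)
  have hu : IsUnit G.det := (isUnit_iff_isUnit_det G).1 hG.isUnit
  have hxc : (x : ℂ) ≠ 0 := by exact_mod_cast hx.ne'
  have hinv : (((x⁻¹ : ℝ) : ℂ) • G)⁻¹ = (x : ℂ) • G⁻¹ := by
    refine inv_eq_left_inv ?_
    rw [smul_mul_smul_comm, nonsing_inv_mul _ hu, Complex.ofReal_inv, mul_inv_cancel₀ hxc,
      one_smul]
  have hdet : (((x⁻¹ : ℝ) : ℂ) • G).det.re = (x ^ p)⁻¹ * G.det.re := by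
    rw [det_smul, Fintype.card_fin, ← Complex.ofReal_pow, Complex.re_ofReal_mul, inv_pow]
  have h := integral_exp_neg_star_dotProduct_mulVec_sub hG' b
  rw [hinv, hdet] at h
  simp only [smul_mulVec, dotProduct_smul, smul_eq_mul, Complex.re_ofReal_mul] at h
  have hdiv (r : ℝ) : -(x⁻¹ * r) = -r / x := by ring
  simp only [hdiv] at h
  refine ⟨h.1, h.2.trans ?_⟩
  field_simp

end Gaussian

section Border

variable {p : ℕ}

/-- The strictly upper-triangular positions of a matrix of size `p + 1` are those in the first row
together with those of the lower right block. -/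
noncomputable def upperIndexEquiv (p : ℕ) :
    Fin p ⊕ { q : Fin p × Fin p // q.1 < q.2 } ≃
      { q : Fin (p + 1) × Fin (p + 1) // q.1 < q.2 } :=
  Equiv.ofBijective
    (Sum.elim (fun j => ⟨(0, j.succ), Fin.succ_pos j⟩)
      (fun q => ⟨(q.1.1.succ, q.1.2.succ), Fin.succ_lt_succ_iff.2 q.2⟩)) (by
    constructor
    · rintro (i | ⟨⟨i, j⟩, h⟩) (k | ⟨⟨k, l⟩, h'⟩) hh <;>
        simp_all [Fin.succ_ne_zero, (Fin.succ_ne_zero _).symm]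
    · rintro ⟨⟨i, j⟩, h⟩
      obtain ⟨j, rfl⟩ := Fin.exists_succ_eq.2 (Fin.ne_zero_of_lt h)
      refine Fin.cases (fun h => ?_) (fun i h => ?_) i h
      · exact ⟨Sum.inl j, rfl⟩
      · exact ⟨Sum.inr ⟨(i, j), Fin.succ_lt_succ_iff.1 h⟩, rfl⟩)

/-- Parameters of a Hermitian matrix of size `p + 1` in terms of its upper left entry, the rest of
its first row, and the parameters of its lower right block. -/
noncomputable def borderParam (p : ℕ) (z : (ℝ × (Fin p → ℂ)) × HermParam p) : HermParam (p + 1) :=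
  (Fin.cons z.1.1 z.2.1, fun q => Sum.elim z.1.2 z.2.2 ((upperIndexEquiv p).symm q))

lemma measurePreserving_prodProdProdComm {α β γ δ : Type*} [MeasureSpace α] [MeasureSpace β]
    [MeasureSpace γ] [MeasureSpace δ] [SFinite (volume : Measure α)]
    [SFinite (volume : Measure β)] [SFinite (volume : Measure γ)] [SFinite (volume : Measure δ)] :
    MeasurePreserving (fun z : (α × β) × (γ × δ) => ((z.1.1, z.2.1), (z.1.2, z.2.2))) := by
  have h1 := volume_preserving_prodAssoc (α₁ := α) (β₁ := β) (γ₁ := γ × δ)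
  have h2 := (volume_preserving_prodAssoc (α₁ := β) (β₁ := γ) (γ₁ := δ)).symm
  have h3 := (Measure.measurePreserving_swap (μ := (volume : Measure β))
    (ν := (volume : Measure γ))).prod (MeasurePreserving.id (volume : Measure δ))
  have h4 := volume_preserving_prodAssoc (α₁ := γ) (β₁ := β) (γ₁ := δ)
  have h5 := (volume_preserving_prodAssoc (α₁ := α) (β₁ := γ) (γ₁ := β × δ)).symm
  exact h5.comp (((MeasurePreserving.id (volume : Measure α)).prod
    (h4.comp (h3.comp h2))).comp h1)

lemma measurePreserving_borderParam (p : ℕ) : MeasurePreserving (borderParam p) := by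
  have h1 := (volume_preserving_piFinSuccAbove (fun _ : Fin (p + 1) => ℝ) 0).symm
  have h2 := (volume_measurePreserving_piCongrLeft (fun _ => ℂ) (upperIndexEquiv p)).comp
    (volume_measurePreserving_sumPiEquivProdPi_symm
      (fun _ : Fin p ⊕ { q : Fin p × Fin p // q.1 < q.2 } => ℂ))
  have h := (h1.prod h2).comp (measurePreserving_prodProdProdComm (α := ℝ) (β := Fin p → ℂ)
    (γ := Fin p → ℝ) (δ := { q : Fin p × Fin p // q.1 < q.2 } → ℂ))
  convert! h using 1
  ext1 ⟨⟨x, y⟩, d, o⟩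
  refine Prod.ext ?_ ?_
  · ext i
    refine Fin.cases ?_ (fun i => ?_) i <;> simp [borderParam]
  · ext q
    obtain ⟨q, rfl⟩ := (upperIndexEquiv p).surjective q
    simp only [borderParam, Equiv.symm_apply_apply, Function.comp_apply, Prod.map_snd,
      MeasurableEquiv.coe_piCongrLeft, Equiv.piCongrLeft_apply_apply]
    cases q <;> rfl

lemma toHermMatrix_isHermitian (T : HermParam p) : (toHermMatrix p T).IsHermitian := by
  ext i j
  simp only [conjTranspose_apply, toHermMatrix, of_apply]
  rcases lt_trichotomy i j with h | rfl | h
  · simp [h, h.not_gt]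
  · simp
  · simp [h, h.not_gt]

lemma toHermMatrix_sub (T S : HermParam p) :
    toHermMatrix p (T - S) = toHermMatrix p T - toHermMatrix p S := by
  ext i j
  simp only [toHermMatrix, of_apply, Matrix.sub_apply]
  split_ifs <;> simp

lemma borderParam_zero_zero (x : ℝ) (y : Fin p → ℂ) (T : HermParam p) :
    toHermMatrix (p + 1) (borderParam p ((x, y), T)) 0 0 = x := by
  simp [toHermMatrix, borderParam]

lemma borderParam_zero_succ (x : ℝ) (y : Fin p → ℂ) (T : HermParam p) (j : Fin p) :
    toHermMatrix (p + 1) (borderParam p ((x, y), T)) 0 j.succ = y j := by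
  simp only [toHermMatrix, borderParam, of_apply, Fin.succ_pos, dite_true]
  rw [show (⟨(0, j.succ), Fin.succ_pos j⟩ : { q : Fin (p + 1) × Fin (p + 1) // q.1 < q.2 }) =
    upperIndexEquiv p (Sum.inl j) from rfl, Equiv.symm_apply_apply, Sum.elim_inl]

lemma borderParam_succ_zero (x : ℝ) (y : Fin p → ℂ) (T : HermParam p) (j : Fin p) :
    toHermMatrix (p + 1) (borderParam p ((x, y), T)) j.succ 0 = star (y j) := by
  rw [← (toHermMatrix_isHermitian _).apply, borderParam_zero_succ]

lemma borderParam_succ_succ (x : ℝ) (y : Fin p → ℂ) (T : HermParam p) (i j : Fin p) :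
    toHermMatrix (p + 1) (borderParam p ((x, y), T)) i.succ j.succ = toHermMatrix p T i j := by
  have key (i j : Fin p) (h : i < j) (h' : i.succ < j.succ) :
      (borderParam p ((x, y), T)).2 ⟨(i.succ, j.succ), h'⟩ = T.2 ⟨(i, j), h⟩ := by
    rw [show (⟨(i.succ, j.succ), h'⟩ : { q : Fin (p + 1) × Fin (p + 1) // q.1 < q.2 }) =
      upperIndexEquiv p (Sum.inr ⟨(i, j), h⟩) from rfl]
    simp [borderParam]
  simp only [toHermMatrix, of_apply, Fin.succ_lt_succ_iff]
  split_ifs with h h'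
  · exact key i j h _
  · rw [key j i h' _]
  · simp [borderParam]

/-- Parameters of the rank one matrix with entries `conj (y i) * y j / x`. -/
noncomputable def rankOneParam (p : ℕ) (z : ℝ × (Fin p → ℂ)) : HermParam p :=
  (fun i => Complex.normSq (z.2 i) / z.1, fun q => star (z.2 q.1.1) * z.2 q.1.2 / (z.1 : ℂ))

lemma toHermMatrix_rankOneParam (x : ℝ) (y : Fin p → ℂ) :
    toHermMatrix p (rankOneParam p (x, y)) = (x : ℂ)⁻¹ • vecMulVec (star y) y := by
  ext i j
  simp only [toHermMatrix, rankOneParam, of_apply, Matrix.smul_apply, vecMulVec_apply,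
    Pi.star_apply, smul_eq_mul]
  rcases lt_trichotomy i j with h | rfl | h
  · simp [h, div_eq_inv_mul]
  · simp [Complex.normSq_eq_conj_mul_self, div_eq_inv_mul]
  · simp [h, h.not_gt, div_eq_inv_mul, mul_comm]

/-- The splitting of `Fin (p + 1)` into its first element and the others. -/
noncomputable def unitSumFinEquiv (p : ℕ) : Unit ⊕ Fin p ≃ Fin (p + 1) :=
  Equiv.ofBijective (Sum.elim (fun _ => 0) Fin.succ) (by
    constructor
    · rintro (i | i) (j | j) h <;> simp_all [Fin.succ_ne_zero, (Fin.succ_ne_zero _).symm]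
    · intro i
      exact Fin.cases ⟨Sum.inl (), rfl⟩ (fun i => ⟨Sum.inr i, rfl⟩) i)

lemma submatrix_unitSumFinEquiv (X : Matrix (Fin (p + 1)) (Fin (p + 1)) ℂ) :
    X.submatrix (unitSumFinEquiv p) (unitSumFinEquiv p) =
      fromBlocks (of fun _ _ => X 0 0) (of fun _ j => X 0 j.succ) (of fun i _ => X i.succ 0)
        (X.submatrix Fin.succ Fin.succ) := by
  ext (i | i) (j | j) <;> rfl

lemma inv_of_unit (a : ℂ) : (of fun _ _ : Unit => a)⁻¹ = of fun _ _ => a⁻¹ := by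
  ext
  simp [Ring.inverse_eq_inv']

lemma det_eq_mul_det_schur (X : Matrix (Fin (p + 1)) (Fin (p + 1)) ℂ) (h : X 0 0 ≠ 0) :
    X.det = X 0 0 * (X.submatrix Fin.succ Fin.succ - (X 0 0)⁻¹ •
      vecMulVec (fun i : Fin p => X i.succ 0) (fun j : Fin p => X 0 j.succ)).det := by
  have hu : IsUnit (of fun _ _ : Unit => X 0 0) := by
    simpa [isUnit_iff_isUnit_det] using h
  have := hu.invertible
  rw [← det_submatrix_equiv_self (unitSumFinEquiv p), submatrix_unitSumFinEquiv,
    det_fromBlocks₁₁, det_unique, of_apply, invOf_eq_nonsing_inv, inv_of_unit]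
  congr 2
  ext i j
  simp [mul_apply, vecMulVec_apply]
  ring

lemma posDef_iff_posDef_schur {X : Matrix (Fin (p + 1)) (Fin (p + 1)) ℂ} (hX : X.IsHermitian)
    (h : 0 < X 0 0) :
    X.PosDef ↔ (X.submatrix Fin.succ Fin.succ - (X 0 0)⁻¹ •
      vecMulVec (fun i : Fin p => X i.succ 0) (fun j : Fin p => X 0 j.succ)).PosDef := by
  have hu : IsUnit (of fun _ _ : Unit => X 0 0) := by
    simpa [isUnit_iff_isUnit_det] using h.ne'
  have := hu.invertible
  have hpos : (of fun _ _ : Unit => X 0 0).PosDef := by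
    rw [show (of fun _ _ : Unit => X 0 0) = diagonal fun _ => X 0 0 by ext; simp]
    exact PosDef.diagonal fun _ => h
  have hsemi : X.PosSemidef ↔ (X.submatrix Fin.succ Fin.succ - (X 0 0)⁻¹ •
      vecMulVec (fun i : Fin p => X i.succ 0) (fun j : Fin p => X 0 j.succ)).PosSemidef := by
    rw [← posSemidef_submatrix_equiv (unitSumFinEquiv p), submatrix_unitSumFinEquiv,
      show (of fun (i : Fin p) (_ : Unit) => X i.succ 0) =
        (of fun (_ : Unit) (j : Fin p) => X 0 j.succ)ᴴ by
        ext i j; exact (hX.apply _ _).symm, PosDef.fromBlocks₁₁ _ _ hpos, inv_of_unit]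
    convert! Iff.rfl using 2
    congr 1
    ext i j
    simp only [Matrix.smul_apply, vecMulVec_apply, mul_apply, Finset.univ_unique,
      Finset.sum_singleton, of_apply, conjTranspose_apply, smul_eq_mul]
    rw [hX.apply]
    ring
  have hdet := det_eq_mul_det_schur X h.ne'
  constructor
  · intro H
    refine (hsemi.1 H.posSemidef).posDef_iff_det_ne_zero.2 fun h0 => H.det_pos.ne' ?_
    rw [hdet, h0, mul_zero]
  · intro H
    refine (hsemi.2 H.posSemidef).posDef_iff_det_ne_zero.2 ?_
    rw [hdet]
    exact mul_ne_zero h.ne' H.det_pos.ne'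

lemma det_eq_det_mul_schur (X : Matrix (Fin (p + 1)) (Fin (p + 1)) ℂ)
    (h : IsUnit (X.submatrix Fin.succ Fin.succ : Matrix (Fin p) (Fin p) ℂ)) :
    X.det = (X.submatrix Fin.succ Fin.succ).det * (X 0 0 - (fun j : Fin p => X 0 j.succ) ⬝ᵥ
      (X.submatrix Fin.succ Fin.succ)⁻¹ *ᵥ fun i => X i.succ 0) := by
  have := h.invertible
  rw [← det_submatrix_equiv_self (unitSumFinEquiv p), submatrix_unitSumFinEquiv,
    det_fromBlocks₂₂, det_unique (n := Unit), invOf_eq_nonsing_inv, Matrix.mul_assoc]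
  rfl

end Border

section GammaIntegral

variable {p : ℕ}

instance matrixBorelSpace (m n : ℕ) : BorelSpace (Matrix (Fin m) (Fin n) ℂ) :=
  inferInstanceAs (BorelSpace (Fin m → Fin n → ℂ))

lemma measurableSet_posDef (p : ℕ) :
    MeasurableSet {X : Matrix (Fin p) (Fin p) ℂ | X.PosDef} := by
  have h : {X : Matrix (Fin p) (Fin p) ℂ | X.PosDef} =
      {X | X.IsHermitian} ∩ (⋂ x : Fin p → ℂ, {X | 0 ≤ star x ⬝ᵥ X *ᵥ x}) ∩ {X | X.det ≠ 0} := by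
    ext X
    simp only [Set.mem_ofPred_eq, Set.mem_inter_iff, Set.mem_iInter,
      ← posSemidef_iff_dotProduct_mulVec]
    exact ⟨fun hX => ⟨hX.posSemidef, hX.det_pos.ne'⟩, fun hX => hX.1.posDef_iff_det_ne_zero.2 hX.2⟩
  rw [h]
  refine ((isClosed_eq (by fun_prop) continuous_id).inter (isClosed_iInter fun x =>
    isClosed_le continuous_const (by fun_prop))).measurableSet.inter
      (isOpen_ne_fun (by fun_prop) continuous_const).measurableSet

lemma measurable_toHermMatrix (p : ℕ) : Measurable (toHermMatrix p) := by
  refine measurable_pi_iff.2 fun i => measurable_pi_iff.2 fun j => ?_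
  simp only [toHermMatrix, of_apply]
  split_ifs <;> fun_prop

lemma measurable_det_cpow_mul_exp_trace (A : Matrix (Fin p) (Fin p) ℂ) (s : ℂ) :
    Measurable fun X : Matrix (Fin p) (Fin p) ℂ =>
      (X.det.re : ℂ) ^ s * Real.exp (-(A * X).trace.re) := by
  have h1 : Measurable fun X : Matrix (Fin p) (Fin p) ℂ => (X.det.re : ℂ) :=
    Continuous.measurable (by fun_prop)
  have h2 : Measurable fun X : Matrix (Fin p) (Fin p) ℂ => (Real.exp (-(A * X).trace.re) : ℂ) :=
    Continuous.measurable (by fun_prop)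
  exact (h1.pow_const s).mul h2

/-- The integrand of the matrix-variate gamma integral in terms of the parameters of a Hermitian
matrix, extended by zero outside of the positive definite cone. -/
noncomputable def gammaIntegrand (A : Matrix (Fin p) (Fin p) ℂ) (α : ℂ) (T : HermParam p) : ℂ :=
  {X : Matrix (Fin p) (Fin p) ℂ | X.PosDef}.indicator
    (fun X => (X.det.re : ℂ) ^ (α - p) * Real.exp (-(A * X).trace.re)) (toHermMatrix p T)

lemma measurable_gammaIntegrand (A : Matrix (Fin p) (Fin p) ℂ) (α : ℂ) :
    Measurable (gammaIntegrand A α) :=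
  ((measurable_det_cpow_mul_exp_trace A _).indicator (measurableSet_posDef p)).comp
    (measurable_toHermMatrix p)

lemma re_trace_mul_borderParam {A : Matrix (Fin (p + 1)) (Fin (p + 1)) ℂ} (hA : A.IsHermitian)
    (x : ℝ) (y : Fin p → ℂ) (T : HermParam p) :
    (A * toHermMatrix (p + 1) (borderParam p ((x, y), T))).trace.re =
      (A 0 0).re * x + 2 * (star (fun j : Fin p => A 0 j.succ) ⬝ᵥ y).re +
      (star y ⬝ᵥ (A.submatrix Fin.succ Fin.succ)ᵀ *ᵥ y).re / x +
      (A.submatrix Fin.succ Fin.succ * toHermMatrix p (T - rankOneParam p (x, y))).trace.re := by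
  have h1 : (A.submatrix Fin.succ Fin.succ * ((x : ℂ)⁻¹ • vecMulVec (star y) y)).trace.re =
      (star y ⬝ᵥ (A.submatrix Fin.succ Fin.succ)ᵀ *ᵥ y).re / x := by
    rw [mul_smul_comm, mul_vecMulVec, trace_smul, trace_vecMulVec, mulVec_transpose,
      dotProduct_comm (star y), ← dotProduct_mulVec, dotProduct_comm y, smul_eq_mul,
      ← Complex.ofReal_inv, Complex.re_ofReal_mul, div_eq_inv_mul]
  have h2 : (∑ j : Fin p, A 0 j.succ * star (y j)).re =
      (star (fun j : Fin p => A 0 j.succ) ⬝ᵥ y).re := by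
    rw [← Complex.conj_re]
    simp [dotProduct]
  have h3 : (∑ j : Fin p, A j.succ 0 * y j) = star (fun j : Fin p => A 0 j.succ) ⬝ᵥ y := by
    refine Finset.sum_congr rfl fun j _ => ?_
    rw [Pi.star_apply, hA.apply]
  rw [toHermMatrix_sub, toHermMatrix_rankOneParam, Matrix.mul_sub, trace_sub, Complex.sub_re, h1]
  simp only [trace, diag_apply, mul_apply, Fin.sum_univ_succ, borderParam_zero_zero,
    borderParam_zero_succ, borderParam_succ_zero, borderParam_succ_succ, Finset.sum_add_distrib,
    Complex.add_re, h2, h3, Complex.re_mul_ofReal, submatrix_apply]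
  ring

/-- The factor of the gamma integrand depending on the upper left entry only. -/
noncomputable def cornerFactor (a : ℝ) (s : ℂ) (x : ℝ) : ℂ :=
  (Set.Ioi (0 : ℝ)).indicator (fun x => (x : ℂ) ^ s * Real.exp (-(a * x))) x

lemma measurable_cornerFactor (a : ℝ) (s : ℂ) : Measurable (cornerFactor a s) := by
  refine Measurable.indicator ?_ measurableSet_Ioi
  exact (Complex.measurable_ofReal.pow_const s).mul
    (Complex.measurable_ofReal.comp (Continuous.measurable (by fun_prop)))

lemma gammaIntegrand_borderParam {A : Matrix (Fin (p + 1)) (Fin (p + 1)) ℂ} (hA : A.IsHermitian)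
    (α : ℂ) (x : ℝ) (y : Fin p → ℂ) (T : HermParam p) :
    gammaIntegrand A α (borderParam p ((x, y), T)) =
      cornerFactor (A 0 0).re (α - (p + 1)) x *
      Real.exp (-(star y ⬝ᵥ (A.submatrix Fin.succ Fin.succ)ᵀ *ᵥ y).re / x -
        2 * (star (fun j : Fin p => A 0 j.succ) ⬝ᵥ y).re) *
      gammaIntegrand (A.submatrix Fin.succ Fin.succ) (α - 1) (T - rankOneParam p (x, y)) := by
  set X := toHermMatrix (p + 1) (borderParam p ((x, y), T)) with hXdef
  have hX00 : X 0 0 = x := borderParam_zero_zero x y T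
  by_cases hx : 0 < x
  · have hpos : 0 < X 0 0 := by rw [hX00]; exact_mod_cast hx
    have hschur : X.submatrix Fin.succ Fin.succ - (X 0 0)⁻¹ •
        vecMulVec (fun i : Fin p => X i.succ 0) (fun j : Fin p => X 0 j.succ) =
        toHermMatrix p (T - rankOneParam p (x, y)) := by
      rw [toHermMatrix_sub, toHermMatrix_rankOneParam]
      ext i j
      simp [X, borderParam_zero_zero, borderParam_zero_succ, borderParam_succ_zero,
        borderParam_succ_succ, vecMulVec_apply]
    have hiff := posDef_iff_posDef_schur (toHermMatrix_isHermitian _ : X.IsHermitian) hpos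
    have hdet := det_eq_mul_det_schur X hpos.ne'
    rw [hschur] at hiff hdet
    by_cases hW : (toHermMatrix p (T - rankOneParam p (x, y))).PosDef
    · have hd : 0 ≤ (toHermMatrix p (T - rankOneParam p (x, y))).det.re :=
        (Complex.pos_iff.1 hW.det_pos).1.le
      rw [gammaIntegrand, gammaIntegrand, cornerFactor,
        Set.indicator_of_mem
          (show X ∈ {X : Matrix (Fin (p + 1)) (Fin (p + 1)) ℂ | X.PosDef} from hiff.2 hW),
        Set.indicator_of_mem (show _ ∈ {X : Matrix (Fin p) (Fin p) ℂ | X.PosDef} from hW),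
        Set.indicator_of_mem (show x ∈ Set.Ioi (0 : ℝ) from hx), hdet, hX00,
        Complex.re_ofReal_mul, Complex.ofReal_mul, Complex.mul_cpow_ofReal_nonneg hx.le hd, hXdef,
        re_trace_mul_borderParam hA,
        show -((A 0 0).re * x + 2 * (star (fun j : Fin p => A 0 j.succ) ⬝ᵥ y).re +
          (star y ⬝ᵥ (A.submatrix Fin.succ Fin.succ)ᵀ *ᵥ y).re / x +
          (A.submatrix Fin.succ Fin.succ *
            toHermMatrix p (T - rankOneParam p (x, y))).trace.re) = -((A 0 0).re * x) +
          (-(star y ⬝ᵥ (A.submatrix Fin.succ Fin.succ)ᵀ *ᵥ y).re / x -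
            2 * (star (fun j : Fin p => A 0 j.succ) ⬝ᵥ y).re) +
          -(A.submatrix Fin.succ Fin.succ *
            toHermMatrix p (T - rankOneParam p (x, y))).trace.re by ring,
        Real.exp_add, Real.exp_add, Nat.cast_succ,
        show α - 1 - (p : ℂ) = α - (p + 1) by ring]
      push_cast
      ring
    · rw [gammaIntegrand, gammaIntegrand,
        Set.indicator_of_notMem
          (show X ∉ {X : Matrix (Fin (p + 1)) (Fin (p + 1)) ℂ | X.PosDef} from mt hiff.1 hW),
        Set.indicator_of_notMem (show _ ∉ {X : Matrix (Fin p) (Fin p) ℂ | X.PosDef} from hW),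
        mul_zero]
  · have hX : ¬ X.PosDef := fun h => hx (by
      have := h.diag_pos (i := 0)
      rw [hX00] at this
      exact_mod_cast this)
    rw [gammaIntegrand, cornerFactor,
      Set.indicator_of_notMem (show X ∉ {X : Matrix _ _ ℂ | X.PosDef} from hX),
      Set.indicator_of_notMem (show x ∉ Set.Ioi (0 : ℝ) from hx), zero_mul, zero_mul]

lemma cGammaP_succ (p : ℕ) (α : ℂ) :
    cGammaP (p + 1) α = (Real.pi : ℂ) ^ p * Complex.Gamma α * cGammaP p (α - 1) := by
  have h : (p + 1) * (p + 1 - 1) / 2 = p + p * (p - 1) / 2 := by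
    rw [← Nat.choose_two_right, ← Nat.choose_two_right, Nat.choose_succ_succ, Nat.choose_one_right]
  rw [cGammaP, cGammaP, h, pow_add, Fin.prod_univ_succ]
  simp only [Fin.val_zero, Nat.cast_zero, sub_zero, Fin.val_succ, Nat.cast_succ]
  rw [Finset.prod_congr rfl fun (j : Fin p) _ =>
    show Complex.Gamma (α - ((j : ℕ) + 1)) = Complex.Gamma (α - 1 - (j : ℕ)) by ring_nf]
  ring

lemma integral_cornerFactor {α : ℂ} {r : ℝ} (hα : 0 < α.re) (hr : 0 < r) :
    Integrable (cornerFactor r (α - 1)) ∧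
    ∫ x, cornerFactor r (α - 1) x = (r : ℂ) ^ (-α) * Complex.Gamma α := by
  have h : ∫ x, cornerFactor r (α - 1) x = (r : ℂ) ^ (-α) * Complex.Gamma α := by
    have h1 := Complex.integral_cpow_mul_exp_neg_mul_Ioi hα hr
    have h2 : ((1 : ℂ) / r) ^ α = (r : ℂ) ^ (-α) := by
      rw [one_div, Complex.inv_cpow _ _ (by
        rw [Complex.arg_ofReal_of_nonneg hr.le]; exact Real.pi_ne_zero.symm), Complex.cpow_neg]
    rw [h2] at h1
    rw [← h1, ← integral_indicator measurableSet_Ioi]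
    simp only [cornerFactor]
    push_cast
    rfl
  refine ⟨not_imp_comm.1 integral_undef ?_, h⟩
  rw [h]
  refine mul_ne_zero ?_ (Complex.Gamma_ne_zero_of_re_pos hα)
  rw [Complex.cpow_def_of_ne_zero (by exact_mod_cast hr.ne')]
  exact Complex.exp_ne_zero _

lemma det_re_eq_mul_sub {A : Matrix (Fin (p + 1)) (Fin (p + 1)) ℂ} (hA : A.PosDef) :
    A.det.re = (A.submatrix Fin.succ Fin.succ : Matrix (Fin p) (Fin p) ℂ).det.re *
      ((A 0 0).re - (star (fun j : Fin p => A 0 j.succ) ⬝ᵥ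
        ((A.submatrix Fin.succ Fin.succ)ᵀ)⁻¹ *ᵥ fun j : Fin p => A 0 j.succ).re) := by
  have hC : (A.submatrix Fin.succ Fin.succ : Matrix (Fin p) (Fin p) ℂ).PosDef :=
    hA.submatrix (Fin.succ_injective _)
  have hCre := (Complex.pos_iff.1 hC.det_pos).2
  have hstar : (fun i : Fin p => A i.succ 0) = star fun j : Fin p => A 0 j.succ := by
    ext i
    rw [Pi.star_apply, hA.isHermitian.apply]
  rw [det_eq_det_mul_schur A hC.isUnit, Complex.mul_re, ← hCre, zero_mul, sub_zero, Complex.sub_re,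
    hstar, ← transpose_nonsing_inv, mulVec_transpose, dotProduct_comm (star _),
    ← dotProduct_mulVec]

end GammaIntegral

section MatrixGamma

variable {p : ℕ}

lemma integrable_mul_comp_sub {W Z : Type*} [MeasureSpace W] [SFinite (volume : Measure W)]
    [MeasureSpace Z] [SFinite (volume : Measure Z)] [AddGroup Z] [MeasurableAdd Z]
    [MeasurableSub₂ Z] [(volume : Measure Z).IsAddRightInvariant]
    {c : W → ℂ} {g : Z → ℂ} {s : W → Z} (hs : Measurable s) (hc : Integrable c) (hg : Integrable g) :
    Integrable (fun z : W × Z => c z.1 * g (z.2 - s z.1)) ∧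
      ∫ z : W × Z, c z.1 * g (z.2 - s z.1) = (∫ w, c w) * ∫ T, g T := by
  have h : MeasurePreserving (fun z : W × Z => (z.1, z.2 - s z.1)) :=
    (MeasurePreserving.id volume).skew_product (g := fun w T => T - s w)
      (measurable_snd.sub (hs.comp measurable_fst))
      (Filter.Eventually.of_forall fun w => (measurePreserving_sub_right volume (s w)).map_eq)
  have hcg := hc.mul_prod hg
  refine ⟨h.integrable_comp_of_integrable hcg, ?_⟩
  have hm := integral_map (μ := volume) h.aemeasurable (f := fun z : W × Z => c z.1 * g z.2)
    (by rw [h.map_eq]; exact hcg.aestronglyMeasurable)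
  rw [← integral_prod_mul c g, ← Measure.volume_eq_prod, ← hm, h.map_eq]

lemma measurable_rankOneParam (p : ℕ) : Measurable (rankOneParam p) := by
  unfold rankOneParam
  fun_prop

instance isAddRightInvariant_volume_hermParam (p : ℕ) :
    (volume : Measure (HermParam p)).IsAddRightInvariant :=
  Measure.prod.instIsAddRightInvariant

lemma integral_cornerFactor_mul_gaussian {A : Matrix (Fin (p + 1)) (Fin (p + 1)) ℂ}
    (hA : A.PosDef) {α : ℂ} (hα : 0 < α.re) :
    let C : Matrix (Fin p) (Fin p) ℂ := A.submatrix Fin.succ Fin.succ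
    let c := fun w : ℝ × (Fin p → ℂ) => cornerFactor (A 0 0).re (α - (p + 1)) w.1 *
      Real.exp (-(star w.2 ⬝ᵥ Cᵀ *ᵥ w.2).re / w.1 -
        2 * (star (fun j : Fin p => A 0 j.succ) ⬝ᵥ w.2).re)
    Integrable c ∧ ∫ w, c w = (Real.pi : ℂ) ^ p * Complex.Gamma α * (C.det.re : ℂ) ^ (α - 1) *
      (A.det.re : ℂ) ^ (-α) := by
  intro C c
  have hC : C.PosDef := hA.submatrix (Fin.succ_injective _)
  have hdA := (Complex.pos_iff.1 hA.det_pos).1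
  have hdC := (Complex.pos_iff.1 hC.det_pos).1
  set r := (A 0 0).re - (star (fun j : Fin p => A 0 j.succ) ⬝ᵥ
        (Cᵀ)⁻¹ *ᵥ fun j : Fin p => A 0 j.succ).re with hr
  have hdet : A.det.re = C.det.re * r := det_re_eq_mul_sub hA
  have hr0 : 0 < r := by
    rw [hdet] at hdA
    exact pos_of_mul_pos_right hdA hdC.le
  have hgauss := fun {x : ℝ} (hx : 0 < x) => integral_exp_neg_star_dotProduct_mulVec_div_sub
    hC.transpose (fun j : Fin p => A 0 j.succ) hx
  have hint (x : ℝ) : Integrable (fun y => c (x, y)) := by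
    by_cases hx : 0 < x
    · exact ((hgauss hx).1.ofReal (𝕜 := ℂ)).const_mul
        (cornerFactor (A 0 0).re (α - (p + 1)) x)
    · simp [c, cornerFactor, hx]
  have hval (x : ℝ) : ∫ y, c (x, y) =
      ((Real.pi ^ p / C.det.re : ℝ) : ℂ) * cornerFactor r (α - 1) x := by
    by_cases hx : 0 < x
    · have h := (hgauss hx).2
      rw [det_transpose] at h
      have hpow : (x : ℂ) ^ (α - (p + 1)) * (x : ℂ) ^ p = (x : ℂ) ^ (α - 1) := by
        rw [← Complex.cpow_natCast, ← Complex.cpow_add _ _ (by exact_mod_cast hx.ne')]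
        ring_nf
      have hexp : Real.exp (-(r * x)) = Real.exp (-((A 0 0).re * x)) *
          Real.exp (x * (star (fun j : Fin p => A 0 j.succ) ⬝ᵥ
            (Cᵀ)⁻¹ *ᵥ fun j : Fin p => A 0 j.succ).re) := by
        rw [← Real.exp_add, hr]
        ring_nf
      simp only [c, cornerFactor]
      rw [integral_const_mul, integral_complex_ofReal, h,
        Set.indicator_of_mem (show x ∈ Set.Ioi (0 : ℝ) from hx),
        Set.indicator_of_mem (show x ∈ Set.Ioi (0 : ℝ) from hx), ← hpow, hexp]
      push_cast
      ring
    · simp [c, cornerFactor, hx]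
  have hnorm (x : ℝ) : ∫ y, ‖c (x, y)‖ = ‖∫ y, c (x, y)‖ := by
    have h (y : Fin p → ℂ) : ‖c (x, y)‖ = ‖cornerFactor (A 0 0).re (α - (p + 1)) x‖ *
        Real.exp (-(star y ⬝ᵥ Cᵀ *ᵥ y).re / x -
          2 * (star (fun j : Fin p => A 0 j.succ) ⬝ᵥ y).re) := by
      rw [norm_mul, Complex.norm_real, Real.norm_of_nonneg (Real.exp_nonneg _)]
    simp only [h, c]
    rw [integral_const_mul, integral_const_mul, integral_complex_ofReal, norm_mul,
      Complex.norm_real, Real.norm_of_nonneg (integral_nonneg fun y => Real.exp_nonneg _)]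
  have hmeas : Measurable c := by
    refine ((measurable_cornerFactor _ _).comp measurable_fst).mul
      (Complex.measurable_ofReal.comp (Real.measurable_exp.comp (Measurable.sub
        (Measurable.div ?_ measurable_fst) ?_)))
    · exact Continuous.measurable (by fun_prop)
    · exact Continuous.measurable (by fun_prop)
  obtain ⟨hci, hcv⟩ := integral_cornerFactor hα hr0
  have hi : Integrable c := by
    refine (integrable_prod_iff hmeas.aestronglyMeasurable).2
      ⟨Filter.Eventually.of_forall hint, ?_⟩
    simp only [hnorm, hval]
    exact (hci.const_mul _).norm
  refine ⟨hi, ?_⟩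
  have hC0 : (C.det.re : ℂ) ≠ 0 := by exact_mod_cast hdC.ne'
  rw [Measure.volume_eq_prod, integral_prod _ hi]
  simp only [hval]
  rw [integral_const_mul, hcv, hdet, Complex.ofReal_mul,
    Complex.mul_cpow_ofReal_nonneg hdC.le hr0.le, Complex.cpow_sub _ _ hC0, Complex.cpow_one,
    Complex.cpow_neg (C.det.re : ℂ)]
  have h0 : (C.det.re : ℂ) ^ α ≠ 0 := by
    rw [Complex.cpow_def_of_ne_zero hC0]
    exact Complex.exp_ne_zero _
  push_cast
  field_simp

lemma integral_gammaIntegrand {A : Matrix (Fin p) (Fin p) ℂ} (hA : A.PosDef) {α : ℂ}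
    (hα : (p - 1 : ℝ) < α.re) :
    Integrable (gammaIntegrand A α) ∧
      ∫ T, gammaIntegrand A α T = cGammaP p α * (A.det.re : ℂ) ^ (-α) := by
  induction p generalizing α with
  | zero =>
    have h : gammaIntegrand A α = fun _ => 1 := by
      ext T
      rw [gammaIntegrand, Set.indicator_of_mem
        (show toHermMatrix 0 T ∈ {X : Matrix (Fin 0) (Fin 0) ℂ | X.PosDef} from ?_)]
      · simp [trace]
      · rw [Subsingleton.elim (toHermMatrix 0 T) A]
        exact hA
    rw [h]
    have hv : (volume : Measure (HermParam 0)) Set.univ = 1 := by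
      rw [Measure.volume_eq_prod, ← Set.univ_prod_univ, Measure.prod_prod]
      simp [volume_pi]
    have : IsProbabilityMeasure (volume : Measure (HermParam 0)) := ⟨hv⟩
    exact ⟨integrable_const _, by simp [cGammaP]⟩
  | succ p ih =>
    have hC : (A.submatrix Fin.succ Fin.succ : Matrix (Fin p) (Fin p) ℂ).PosDef :=
      hA.submatrix (Fin.succ_injective _)
    push_cast at hα
    have hp : (0 : ℝ) ≤ p := p.cast_nonneg
    obtain ⟨hgi, hgv⟩ := ih hC (α := α - 1) (by
      rw [Complex.sub_re, Complex.one_re]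
      linarith)
    obtain ⟨hci, hcv⟩ := integral_cornerFactor_mul_gaussian hA (α := α) (by linarith)
    obtain ⟨hi, hv⟩ := integrable_mul_comp_sub (measurable_rankOneParam p) hci hgi
    have hF : (fun z => gammaIntegrand A α (borderParam p z)) = _ :=
      funext fun z => gammaIntegrand_borderParam hA.isHermitian α z.1.1 z.1.2 z.2
    have hb := measurePreserving_borderParam p
    have hm := (measurable_gammaIntegrand A α).aestronglyMeasurable (μ := volume)
    refine ⟨(hb.integrable_comp hm).1 (hi.congr (Filter.Eventually.of_forall
      fun z => (congrFun hF z).symm)), ?_⟩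
    rw [← hb.map_eq, integral_map hb.aemeasurable (hb.map_eq.symm ▸ hm), hF]
    refine hv.trans ?_
    have hC0 : ((A.submatrix Fin.succ Fin.succ : Matrix (Fin p) (Fin p) ℂ).det.re : ℂ) ≠ 0 := by
      exact_mod_cast (Complex.pos_iff.1 hC.det_pos).1.ne'
    have h1 : ((A.submatrix Fin.succ Fin.succ : Matrix (Fin p) (Fin p) ℂ).det.re : ℂ) ^ (α - 1) *
        ((A.submatrix Fin.succ Fin.succ : Matrix (Fin p) (Fin p) ℂ).det.re : ℂ) ^ (-(α - 1)) =
        1 := by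
      rw [← Complex.cpow_add _ _ hC0, add_neg_cancel, Complex.cpow_zero]
    rw [hcv, hgv, cGammaP_succ]
    linear_combination ((Real.pi : ℂ) ^ p * Complex.Gamma α * cGammaP p (α - 1) *
      (A.det.re : ℂ) ^ (-α)) * h1

end MatrixGamma

theorem stmt15 (p : ℕ) (hp : 1 ≤ p) (A : Matrix (Fin p) (Fin p) ℂ) (hA : A.PosDef)
    (α : ℂ) (hα : (p - 1 : ℝ) < α.re) :
    ∫ X in {X : Matrix (Fin p) (Fin p) ℂ | X.PosDef},
      ((X.det.re : ℂ) ^ (α - p) * Real.exp (-(A * X).trace.re)) ∂(hermLebesgue p)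
    = cGammaP p α * (A.det.re : ℂ) ^ (-α) := by
  rw [← integral_indicator (measurableSet_posDef p), hermLebesgue,
    integral_map (measurable_toHermMatrix p).aemeasurable
      ((measurable_det_cpow_mul_exp_trace A _).indicator
        (measurableSet_posDef p)).aestronglyMeasurable]
  exact (integral_gammaIntegrand hA hα).2
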